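/- Let Δ ≥ 7 be an integer and let G be a minimal counterexample to the bound χ'_s ≤ 3Δ for graphs with Mad ≤ 3, maximum degree at most Δ, and no 3-regular subgraph. If v is a sponsor of a very poor vertex u, then v has degree exactly Δ in G*. -/

import Mathlib

open scoped Classical

namespace StrongEC

/-- Two edges of `G` conflict for strong edge-coloring: they are distinct and either share
an endpoint or are both adjacent to a common edge of `G`. -/
def Conflict {V : Type*} (G : SimpleGraph V) (e e' : Sym2 V) : Prop :=
  e ≠ e' ∧ ((∃ v, v ∈ e ∧ v ∈ e') ∨
    ∃ f ∈ G.edgeSet, (∃ v, v ∈ e ∧ v ∈ f) ∧ (∃ w, w ∈ e' ∧ w ∈ f))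

/-- `C` is a strong edge-coloring of `G` with `k` colors. -/
def IsStrongColoring {V : Type*} (G : SimpleGraph V) {k : ℕ} (C : Sym2 V → Fin k) : Prop :=
  ∀ e ∈ G.edgeSet, ∀ e' ∈ G.edgeSet, Conflict G e e' → C e ≠ C e'

/-- `G` admits a strong `k`-edge-coloring. -/
def HasStrongColoring {V : Type*} (G : SimpleGraph V) (k : ℕ) : Prop :=
  ∃ C : Sym2 V → Fin k, IsStrongColoring G C

/-- The strong chromatic index of `G`: the least `k` such that `G` admits a strong
`k`-edge-coloring. -/
noncomputable def strongChromaticIndex {V : Type*} (G : SimpleGraph V) : ℕ :=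
  sInf {k | HasStrongColoring G k}

/-- The maximum average degree of a finite graph `G`: the supremum over nonempty vertex
subsets `A` of `2 * e(A) / |A|`, where `e(A)` is the number of edges of `G` inside `A`
(this equals the maximum of `2|E(H)|/|V(H)|` over all subgraphs `H` with at least one
vertex). -/
noncomputable def mad {V : Type*} (G : SimpleGraph V) : ℝ :=
  sSup {x : ℝ | ∃ A : Finset V, A.Nonempty ∧
    x = 2 * ({e ∈ G.edgeSet | ∀ v ∈ e, v ∈ A}.ncard : ℝ) / (A.card : ℝ)}

/-- `G` has a 3-regular subgraph: a subgraph on a nonempty vertex set all of whose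
vertices have degree exactly 3 in it. -/
def Has3RegularSubgraph {V : Type*} (G : SimpleGraph V) : Prop :=
  ∃ H : SimpleGraph V, H ≤ G ∧ H.support.Nonempty ∧
    ∀ v ∈ H.support, (H.neighborSet v).ncard = 3

/-- The graph `G*` obtained from `G` by deleting all vertices of degree 1 in `G`. -/
noncomputable def core {V : Type*} [Fintype V] (G : SimpleGraph V) : SimpleGraph V :=
  SimpleGraph.fromRel (fun u v => G.Adj u v ∧ G.degree u ≠ 1 ∧ G.degree v ≠ 1)

/-- The number of vertices of degree at least 2. -/
noncomputable def twoPlusCount {W : Type} [Fintype W] (H : SimpleGraph W) : ℕ :=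
  (Finset.univ.filter (fun v : W => 2 ≤ H.degree v)).card

/-- A graph with maximum average degree at most `3`, maximum degree at most `Δ`, and no
3-regular subgraph. -/
def GoodB (Δ : ℕ) {W : Type} [Fintype W] (H : SimpleGraph W) : Prop :=
  mad H ≤ 3 ∧ H.maxDegree ≤ Δ ∧ ¬ Has3RegularSubgraph H

/-- `G` is a minimal counterexample to the bound `χ'_s ≤ 3Δ` for graphs with `Mad ≤ 3`,
maximum degree at most `Δ` and no 3-regular subgraph. -/
def MinCexB (Δ : ℕ) {V : Type} [Fintype V] (G : SimpleGraph V) : Prop :=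
  GoodB Δ G ∧ ¬ HasStrongColoring G (3 * Δ) ∧
    ∀ (W : Type) [Fintype W] (H : SimpleGraph W), GoodB Δ H →
      (twoPlusCount H < twoPlusCount G ∨
        (twoPlusCount H = twoPlusCount G ∧ H.edgeSet.ncard < G.edgeSet.ncard)) →
      HasStrongColoring H (3 * Δ)

/-- A poor 3-vertex: a vertex of degree 3 in `G*` exactly one of whose neighbors in `G*`
has degree 2 in `G*`. -/
def Poor3 {V : Type} [Fintype V] (G : SimpleGraph V) (v : V) : Prop :=
  (core G).degree v = 3 ∧
    (((core G).neighborFinset v).filter (fun u => (core G).degree u = 2)).card = 1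

/-- `u` is a very poor vertex with sponsor `v` and rival `w`: `u` has degree 2 in `G*`
with neighbors `v` and `w` in `G*`, and one of (T1), (T2), (T3) holds for `w`. -/
def VeryPoorWith {V : Type} [Fintype V] (G : SimpleGraph V) (u v w : V) : Prop :=
  (core G).degree u = 2 ∧ (core G).Adj u v ∧ (core G).Adj u w ∧ v ≠ w ∧
    ((core G).degree w = 2 ∨
      ((core G).degree w = 3 ∧
        2 ≤ (((core G).neighborFinset w).filter (fun x => (core G).degree x = 2)).card) ∨
      ((core G).degree w = 4 ∧
        (((core G).neighborFinset w).filter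
          (fun x => ¬ ((core G).degree x = 2 ∨ Poor3 G x))).card ≤ 1))

/-! ### Auxiliary lemmas -/

lemma Conflict.symm' {V : Type*} {G : SimpleGraph V} {e e' : Sym2 V} (h : Conflict G e e') :
    Conflict G e' e := by
  obtain ⟨h1, h2⟩ := h
  refine ⟨h1.symm, ?_⟩
  rcases h2 with ⟨v, a, b⟩ | ⟨f, hf, a, b⟩
  · exact Or.inl ⟨v, b, a⟩
  · exact Or.inr ⟨f, hf, b, a⟩

/-- The coloring `C` is proper on the set `S` of edges, with respect to conflicts in `G`. -/
def PartialOK {V : Type*} (G : SimpleGraph V) (S : Set (Sym2 V)) {k : ℕ} (C : Sym2 V → Fin k) :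
    Prop :=
  ∀ e ∈ S, ∀ e' ∈ S, Conflict G e e' → C e ≠ C e'

lemma extend_coloring {V : Type*} (G : SimpleGraph V) (S : Set (Sym2 V)) {k : ℕ}
    (C : Sym2 V → Fin k) (hC : PartialOK G S C) (e : Sym2 V) (B : Finset (Sym2 V))
    (hB : ∀ e' ∈ S, Conflict G e e' → e' ∈ B) (hk : B.card < k) :
    ∃ C' : Sym2 V → Fin k, PartialOK G (insert e S) C' := by
  obtain ⟨c, hc⟩ : ∃ c : Fin k, c ∉ B.image C := by
    by_contra! hcon
    have h1 : (Finset.univ : Finset (Fin k)).card ≤ (B.image C).card :=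
      Finset.card_le_card (fun x _ => hcon x)
    have h2 : (B.image C).card ≤ B.card := Finset.card_image_le
    simp at h1
    omega
  have key : ∀ e' ∈ S, Conflict G e e' → c ≠ C e' := by
    intro e' he' hcf heq
    exact hc (Finset.mem_image.2 ⟨e', hB e' he' hcf, heq.symm⟩)
  refine ⟨Function.update C e c, ?_⟩
  intro e1 h1 e2 h2 hcf
  by_cases he1 : e1 = e
  · subst he1
    have hne : e2 ≠ e1 := hcf.1.symm
    rw [Function.update_self, Function.update_of_ne hne]
    exact key e2 (h2.resolve_left hne) hcf
  · by_cases he2 : e2 = e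
    · subst he2
      rw [Function.update_self, Function.update_of_ne he1]
      exact (key e1 (h1.resolve_left he1) hcf.symm').symm
    · rw [Function.update_of_ne he1, Function.update_of_ne he2]
      exact hC e1 (h1.resolve_left he1) e2 (h2.resolve_left he2) hcf

/-- Sum of the degrees of the neighbors of `a` other than `b`. -/
noncomputable def nb {V : Type} [Fintype V] (G : SimpleGraph V) (a b : V) : ℕ :=
  ∑ p ∈ (G.neighborFinset a).erase b, G.degree p

/-- Edges incident to a neighbor of `a` other than `b`. -/
noncomputable def nbE {V : Type} [Fintype V] (G : SimpleGraph V) (a b : V) :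
    Finset (Sym2 V) :=
  ((G.neighborFinset a).erase b).biUnion (fun p => G.incidenceFinset p)

lemma card_nbE {V : Type} [Fintype V] (G : SimpleGraph V) (a b : V) :
    (nbE G a b).card ≤ nb G a b := by
  unfold nbE nb
  refine Finset.card_biUnion_le.trans (le_of_eq ?_)
  refine Finset.sum_congr rfl (fun p _ => ?_)
  exact G.card_incidenceFinset_eq_degree p

lemma mem_nbE {V : Type} [Fintype V] (G : SimpleGraph V) (a b : V) (e : Sym2 V) :
    e ∈ nbE G a b ↔ ∃ p, p ≠ b ∧ G.Adj a p ∧ e ∈ G.edgeSet ∧ p ∈ e := by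
  simp [nbE, SimpleGraph.incidenceSet, and_assoc]

lemma conflict_mem {V : Type} [Fintype V] (G : SimpleGraph V) (a b : V) (e : Sym2 V)
    (he : e ∈ G.edgeSet) (hc : Conflict G s(a, b) e) : e ∈ nbE G a b ∪ nbE G b a := by
  have base : ∀ a b : V, Conflict G s(a, b) e → a ∈ e → e ∈ nbE G a b := by
    intro a b hc ha
    obtain ⟨q, rfl⟩ := Sym2.mem_iff_exists.1 ha
    rw [mem_nbE]
    refine ⟨q, ?_, he, he, by simp⟩
    rintro rfl
    exact hc.1 rfl
  have hc' : Conflict G s(b, a) e := by rwa [Sym2.eq_swap]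
  have med : ∀ a b : V, Conflict G s(a, b) e → Conflict G s(b, a) e →
      (∃ f ∈ G.edgeSet, a ∈ f ∧ ∃ w, w ∈ e ∧ w ∈ f) → e ∈ nbE G a b ∪ nbE G b a := by
    rintro a b hc hc' ⟨f, hf, haf, w, hwe, hwf⟩
    obtain ⟨q, rfl⟩ := Sym2.mem_iff_exists.1 haf
    rw [Finset.mem_union]
    rcases Sym2.mem_iff.1 hwf with rfl | rfl
    · exact Or.inl (base _ _ hc hwe)
    · by_cases hqb : w = b
      · subst hqb
        exact Or.inr (base _ _ hc' hwe)
      · exact Or.inl ((mem_nbE _ _ _ _).2 ⟨w, hqb, hf, he, hwe⟩)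
  rcases hc.2 with ⟨p, hp, hpe⟩ | ⟨f, hf, ⟨p, hp, hpf⟩, hw⟩
  · rw [Finset.mem_union]
    rcases Sym2.mem_iff.1 hp with rfl | rfl
    · exact Or.inl (base _ _ hc hpe)
    · exact Or.inr (base _ _ hc' hpe)
  · rcases Sym2.mem_iff.1 hp with rfl | rfl
    · exact med _ _ hc hc' ⟨f, hf, hpf, hw⟩
    · rw [Finset.union_comm]
      exact med _ _ hc' hc ⟨f, hf, hpf, hw⟩

/-! ### Maximum average degree -/

lemma mad_le_iff {V : Type} [Fintype V] (G : SimpleGraph V) :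
    mad G ≤ 3 ↔ ∀ A : Finset V, 2 * ({e ∈ G.edgeSet | ∀ v ∈ e, v ∈ A}.ncard) ≤ 3 * A.card := by
  have hfin : {x : ℝ | ∃ A : Finset V, A.Nonempty ∧
    x = 2 * ({e ∈ G.edgeSet | ∀ v ∈ e, v ∈ A}.ncard : ℝ) / (A.card : ℝ)}.Finite := by
    refine (Set.finite_range (fun A : Finset V =>
      2 * ({e ∈ G.edgeSet | ∀ v ∈ e, v ∈ A}.ncard : ℝ) / (A.card : ℝ))).subset ?_
    rintro x ⟨A, _, rfl⟩
    exact ⟨A, rfl⟩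
  constructor
  · intro h A
    rcases A.eq_empty_or_nonempty with rfl | hA
    · have : {e ∈ G.edgeSet | ∀ v ∈ e, v ∈ (∅ : Finset V)} = ∅ := by
        ext e
        induction e with
        | _ x y =>
          simp only [Set.mem_setOf_eq, Set.mem_empty_iff_false, iff_false]
          rintro ⟨-, h⟩
          exact absurd (h x (by simp)) (by simp)
      rw [this]; simp
    · have h1 := (le_csSup hfin.bddAbove ⟨A, hA, rfl⟩).trans h
      have hpos : (0 : ℝ) < A.card := by exact_mod_cast hA.card_pos
      rw [div_le_iff₀ hpos] at h1
      exact_mod_cast h1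
  · intro h
    unfold mad
    refine Real.sSup_le ?_ (by norm_num)
    rintro x ⟨A, hA, rfl⟩
    have hpos : (0 : ℝ) < A.card := by exact_mod_cast hA.card_pos
    rw [div_le_iff₀ hpos]
    exact_mod_cast h A

lemma degree_mono {V : Type} [Fintype V] {H G : SimpleGraph V} (h : H ≤ G) (x : V) :
    H.degree x ≤ G.degree x := by
  unfold SimpleGraph.degree
  refine Finset.card_le_card (fun y hy => ?_)
  rw [SimpleGraph.mem_neighborFinset] at *
  exact h hy

lemma GoodB.degree_le {V : Type} [Fintype V] {Δ : ℕ} {G : SimpleGraph V} (h : GoodB Δ G) (x : V) :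
    G.degree x ≤ Δ := (G.degree_le_maxDegree x).trans h.2.1

lemma GoodB.mono {V : Type} [Fintype V] {Δ : ℕ} {H G : SimpleGraph V} (h : H ≤ G)
    (hG : GoodB Δ G) : GoodB Δ H := by
  refine ⟨?_, ?_, ?_⟩
  · rw [mad_le_iff]
    intro A
    refine le_trans ?_ ((mad_le_iff G).1 hG.1 A)
    refine Nat.mul_le_mul_left 2 (Set.ncard_le_ncard ?_ (Set.toFinite _))
    rintro e ⟨he, hA⟩
    exact ⟨SimpleGraph.edgeSet_mono h he, hA⟩
  · exact SimpleGraph.maxDegree_le_of_forall_degree_le _ _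
      (fun x => (degree_mono h x).trans (hG.degree_le x))
  · rintro ⟨K, hK, h1, h2⟩
    exact hG.2.2 ⟨K, hK.trans h, h1, h2⟩

lemma twoPlusCount_mono {V : Type} [Fintype V] {H G : SimpleGraph V} (h : H ≤ G) :
    twoPlusCount H ≤ twoPlusCount G := by
  unfold twoPlusCount
  refine Finset.card_le_card (fun x hx => ?_)
  simp only [Finset.mem_filter, Finset.mem_univ, true_and] at *
  exact hx.trans (degree_mono h x)

/-! ### Pendant edges -/

lemma leaf_unique {V : Type} [Fintype V] {G : SimpleGraph V} {l x y : V} (h : G.degree l = 1)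
    (hx : G.Adj l x) (hy : G.Adj l y) : x = y := by
  unfold SimpleGraph.degree at h
  obtain ⟨a, ha⟩ := Finset.card_eq_one.1 h
  have h1 : x ∈ G.neighborFinset l := by simpa using hx
  have h2 : y ∈ G.neighborFinset l := by simpa using hy
  rw [ha, Finset.mem_singleton] at h1 h2
  rw [h1, h2]

lemma no_leaf {V : Type} [Fintype V] {G : SimpleGraph V} {Δ : ℕ} (hG : MinCexB Δ G) {x l : V}
    (hxl : G.Adj x l) (hl : G.degree l = 1) (hs : nb G x l < 3 * Δ) : False := by
  obtain ⟨hgood, hno, hmin⟩ := hG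
  set H := G.deleteEdges {s(x, l)} with hH
  have hle : H ≤ G := G.deleteEdges_le _
  have hE : ∀ e, e ∈ H.edgeSet ↔ e ∈ G.edgeSet ∧ e ≠ s(x, l) := by
    intro e
    rw [hH, SimpleGraph.edgeSet_deleteEdges]
    simp
  have hlt : H.edgeSet.ncard < G.edgeSet.ncard := by
    refine Set.ncard_lt_ncard ?_ (Set.toFinite _)
    refine ⟨SimpleGraph.edgeSet_mono hle, fun hcon => ?_⟩
    exact ((hE s(x, l)).1 (hcon hxl)).2 rfl
  obtain ⟨C, hC⟩ := hmin V H (hgood.mono hle) (by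
    rcases (twoPlusCount_mono hle).lt_or_eq with h | h
    · exact Or.inl h
    · exact Or.inr ⟨h, hlt⟩)
  have hmem : ∀ e ∈ H.edgeSet, l ∉ e := by
    intro e he hle'
    obtain ⟨q, rfl⟩ := Sym2.mem_iff_exists.1 hle'
    have h1 := (hE _).1 he
    have : q = x := leaf_unique hl h1.1 hxl.symm
    subst this
    exact h1.2 Sym2.eq_swap
  have hP : PartialOK G H.edgeSet C := by
    intro e he e' he' hcf
    refine hC e he e' he' ⟨hcf.1, ?_⟩
    rcases hcf.2 with h | ⟨f, hf, ⟨p, hp, hpf⟩, ⟨q, hq, hqf⟩⟩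
    · exact Or.inl h
    · by_cases hfe : f = s(x, l)
      · subst hfe
        left
        rcases Sym2.mem_iff.1 hpf with rfl | rfl
        · rcases Sym2.mem_iff.1 hqf with rfl | rfl
          · exact ⟨_, hp, hq⟩
          · exact absurd hq (hmem _ he')
        · exact absurd hp (hmem _ he)
      · exact Or.inr ⟨f, (hE f).2 ⟨hf, hfe⟩, ⟨p, hp, hpf⟩, ⟨q, hq, hqf⟩⟩
  have hz : nbE G l x = ∅ := by
    ext e
    rw [mem_nbE]
    constructor
    · rintro ⟨p, hp, hlp, -⟩
      exact absurd (leaf_unique hl hlp hxl.symm) hp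
    · simp
  obtain ⟨C', hC'⟩ := extend_coloring G H.edgeSet C hP s(x, l) (nbE G x l)
    (by
      intro e' he' hcf
      have := conflict_mem G x l e' (SimpleGraph.edgeSet_mono hle he') hcf
      rwa [hz, Finset.union_empty] at this)
    ((card_nbE G x l).trans_lt hs)
  refine hno ⟨C', fun e he e' he' hcf => hC' e ?_ e' ?_ hcf⟩
  · by_cases h : e = s(x, l)
    · exact Or.inl h
    · exact Or.inr ((hE e).2 ⟨he, h⟩)
  · by_cases h : e' = s(x, l)
    · exact Or.inl h
    · exact Or.inr ((hE e').2 ⟨he', h⟩)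

lemma core_adj {V : Type} [Fintype V] {G : SimpleGraph V} {x y : V} :
    (core G).Adj x y ↔ G.Adj x y ∧ G.degree x ≠ 1 ∧ G.degree y ≠ 1 := by
  unfold core
  rw [SimpleGraph.fromRel_adj]
  constructor
  · rintro ⟨_, h | h⟩
    · exact h
    · exact ⟨h.1.symm, h.2.2, h.2.1⟩
  · intro h
    exact ⟨h.1.ne, Or.inl h⟩

lemma core_le {V : Type} [Fintype V] (G : SimpleGraph V) : core G ≤ G :=
  fun _ _ h => (core_adj.1 h).1

lemma leafless {V : Type} [Fintype V] {G : SimpleGraph V} {Δ : ℕ} (hG : MinCexB Δ G) {x : V}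
    (hx : G.degree x ≠ 1)
    (hs : ∑ p ∈ (core G).neighborFinset x, G.degree p ≤ 2 * Δ + (core G).degree x) :
    (core G).neighborFinset x = G.neighborFinset x := by
  by_contra hne
  have hsub : (core G).neighborFinset x ⊆ G.neighborFinset x := by
    intro y hy
    rw [SimpleGraph.mem_neighborFinset] at *
    exact core_le G hy
  obtain ⟨l, hl, hl'⟩ := Finset.exists_of_ssubset (hsub.ssubset_of_ne hne)
  rw [SimpleGraph.mem_neighborFinset] at hl hl'
  have hleaf : ∀ y, G.Adj x y → ¬ (core G).Adj x y → G.degree y = 1 := by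
    intro y h1 h2
    by_contra h3
    exact h2 (core_adj.2 ⟨h1, hx, h3⟩)
  have hl1 := hleaf l hl hl'
  refine no_leaf hG hl hl1 ?_
  have htot : ∑ p ∈ G.neighborFinset x, G.degree p =
      ∑ p ∈ G.neighborFinset x \ (core G).neighborFinset x, G.degree p +
      ∑ p ∈ (core G).neighborFinset x, G.degree p := (Finset.sum_sdiff hsub).symm
  have h1 : ∑ p ∈ G.neighborFinset x \ (core G).neighborFinset x, G.degree p =
      (G.neighborFinset x \ (core G).neighborFinset x).card := by
    rw [Finset.card_eq_sum_ones]
    refine Finset.sum_congr rfl (fun p hp => ?_)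
    rw [Finset.mem_sdiff, SimpleGraph.mem_neighborFinset, SimpleGraph.mem_neighborFinset] at hp
    exact hleaf p hp.1 hp.2
  have h2 : (G.neighborFinset x \ (core G).neighborFinset x).card + (core G).degree x =
      G.degree x := Finset.card_sdiff_add_card_eq_card hsub
  have h3 : nb G x l + G.degree l = ∑ p ∈ G.neighborFinset x, G.degree p :=
    Finset.sum_erase_add _ _ (by simpa using hl)
  have h4 := hG.1.degree_le x
  have h5 : 1 ≤ (G.neighborFinset x \ (core G).neighborFinset x).card :=
    Finset.card_pos.2 ⟨l, by simp [hl, hl']⟩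
  omega

/-! ### Swapping two pendant edges -/

lemma conflict_map {W : Type} {H : SimpleGraph W} (σ : Equiv.Perm W)
    (hσ : ∀ x y, H.Adj x y → H.Adj (σ x) (σ y)) {e e' : Sym2 W} (hc : Conflict H e e') :
    Conflict H (e.map σ) (e'.map σ) := by
  obtain ⟨h1, h2⟩ := hc
  refine ⟨fun h => h1 (Sym2.map.injective σ.injective h), ?_⟩
  rcases h2 with ⟨p, hp, hp'⟩ | ⟨f, hf, ⟨p, hp, hpf⟩, ⟨q, hq, hqf⟩⟩
  · exact Or.inl ⟨σ p, Sym2.mem_map.2 ⟨p, hp, rfl⟩, Sym2.mem_map.2 ⟨p, hp', rfl⟩⟩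
  · refine Or.inr ⟨f.map σ, ?_, ⟨σ p, Sym2.mem_map.2 ⟨p, hp, rfl⟩, Sym2.mem_map.2 ⟨p, hpf, rfl⟩⟩,
      ⟨σ q, Sym2.mem_map.2 ⟨q, hq, rfl⟩, Sym2.mem_map.2 ⟨q, hqf, rfl⟩⟩⟩
    induction f with
    | _ x y => exact hσ x y hf

lemma swap_coloring {W : Type} (H : SimpleGraph W) {k : ℕ} (hC : HasStrongColoring H k)
    {u l v w z : W} (hul : u ≠ l) (hu : ∀ y, H.Adj u y ↔ y = v) (hl : ∀ y, H.Adj l y ↔ y = v)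
    (hwu : w ≠ u) (hwl : w ≠ l) (hzu : z ≠ u) (hzl : z ≠ l) :
    ∃ C : Sym2 W → Fin k, IsStrongColoring H C ∧ C s(u, v) ≠ C s(w, z) := by
  obtain ⟨C, hC⟩ := hC
  by_cases hcon : C s(u, v) = C s(w, z)
  swap
  · exact ⟨C, hC, hcon⟩
  have huv : H.Adj u v := (hu v).2 rfl
  have hlv : H.Adj l v := (hl v).2 rfl
  have hvu : v ≠ u := huv.ne'
  have hvl : v ≠ l := hlv.ne'
  set σ := Equiv.swap u l with hσd
  have hσv : σ v = v := Equiv.swap_apply_of_ne_of_ne hvu hvl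
  have hσ : ∀ x y, H.Adj x y → H.Adj (σ x) (σ y) := by
    have one : ∀ x y, (x = u ∨ x = l) → H.Adj x y → H.Adj (σ x) (σ y) := by
      rintro x y (rfl | rfl) hxy
      · rw [(hu y).1 hxy, hσv, Equiv.swap_apply_left]; exact hlv
      · rw [(hl y).1 hxy, hσv, Equiv.swap_apply_right]; exact huv
    intro x y hxy
    by_cases hx : x = u ∨ x = l
    · exact one x y hx hxy
    · by_cases hy : y = u ∨ y = l
      · exact (one y x hy hxy.symm).symm
      · push Not at hx hy
        rw [hσd, Equiv.swap_apply_of_ne_of_ne hx.1 hx.2, Equiv.swap_apply_of_ne_of_ne hy.1 hy.2]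
        exact hxy
  have hσe : ∀ e ∈ H.edgeSet, e.map σ ∈ H.edgeSet := by
    intro e he
    induction e with
    | _ x y => exact hσ x y he
  refine ⟨fun e => C (e.map σ), ?_, ?_⟩
  · intro e he e' he' hcf
    exact hC _ (hσe e he) _ (hσe e' he') (conflict_map σ hσ hcf)
  · have e1 : Sym2.map σ s(u, v) = s(l, v) := by
      rw [Sym2.map_mk]
      rw [hσv, hσd, Equiv.swap_apply_left]
    have e2 : Sym2.map σ s(w, z) = s(w, z) := by
      rw [Sym2.map_mk, hσd, Equiv.swap_apply_of_ne_of_ne hwu hwl,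
        Equiv.swap_apply_of_ne_of_ne hzu hzl]
    simp only [e1, e2]
    rw [← hcon]
    refine hC s(l, v) hlv s(u, v) huv ⟨?_, Or.inl ⟨v, by simp, by simp⟩⟩
    intro h
    rw [Sym2.eq_iff] at h
    rcases h with h | h
    · exact hul h.1.symm
    · exact hvl h.1.symm

/-! ### Adding a pendant edge -/

/-- `H` with a new vertex `none` attached to `v`. -/
def addLeaf {V : Type} (H : SimpleGraph V) (v : V) : SimpleGraph (Option V) where
  Adj a b := match a, b with
    | some x, some y => H.Adj x y
    | some x, none => x = v
    | none, some y => y = v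
    | none, none => False
  symm := ⟨by
    intro a b h
    cases a <;> cases b <;> simp_all [SimpleGraph.adj_comm]⟩
  loopless := ⟨by
    intro a h
    cases a <;> simp_all⟩

lemma addLeaf_degree_some {V : Type} [Fintype V] (H : SimpleGraph V) (v x : V) :
    (addLeaf H v).degree (some x) = H.degree x + if x = v then 1 else 0 := by
  unfold SimpleGraph.degree
  split_ifs with h
  · subst h
    have : (addLeaf H x).neighborFinset (some x) =
        insert none ((H.neighborFinset x).map Function.Embedding.some) := by
      ext a
      rw [SimpleGraph.mem_neighborFinset]
      cases a <;> simp [addLeaf]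
    rw [this, Finset.card_insert_of_notMem (by simp), Finset.card_map]
  · have : (addLeaf H v).neighborFinset (some x) =
        ((H.neighborFinset x).map Function.Embedding.some) := by
      ext a
      rw [SimpleGraph.mem_neighborFinset]
      cases a <;> simp [addLeaf, h]
    rw [this, Finset.card_map]; rfl

lemma addLeaf_degree_none {V : Type} [Fintype V] (H : SimpleGraph V) (v : V) :
    (addLeaf H v).degree none = 1 := by
  unfold SimpleGraph.degree
  have : (addLeaf H v).neighborFinset none = {some v} := by
    ext a
    rw [SimpleGraph.mem_neighborFinset]
    cases a <;> simp [addLeaf]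
  rw [this, Finset.card_singleton]

lemma addLeaf_good {V : Type} [Fintype V] {Δ : ℕ} {H : SimpleGraph V} (hH : GoodB Δ H) {v : V}
    (hv : H.degree v < Δ) : GoodB Δ (addLeaf H v) := by
  refine ⟨?_, ?_, ?_⟩
  · rw [mad_le_iff]
    intro A
    set A' := A.eraseNone with hA'
    have h1 := (mad_le_iff H).1 hH.1 A'
    set E' := {e ∈ H.edgeSet | ∀ v ∈ e, v ∈ A'} with hE'
    have hsub : {e ∈ (addLeaf H v).edgeSet | ∀ v ∈ e, v ∈ A} ⊆
        (Sym2.map some '' E') ∪ (if none ∈ A then {s(some v, none)} else ∅) := by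
      rintro e ⟨he, heA⟩
      induction e with
      | _ a b =>
        rw [SimpleGraph.mem_edgeSet] at he
        have ha := heA a (by simp)
        have hb := heA b (by simp)
        cases a with
        | none =>
          cases b with
          | none => exact absurd he (by simp)
          | some y =>
            have : y = v := he
            subst this
            right; rw [if_pos ha]; exact Sym2.eq_swap
        | some x =>
          cases b with
          | none =>
            have : x = v := he
            subst this
            right; rw [if_pos hb]; rfl
          | some y =>
            left
            refine ⟨s(x, y), ⟨he, ?_⟩, rfl⟩
            intro q hq
            rw [hA', Finset.mem_eraseNone]
            rcases Sym2.mem_iff.1 hq with rfl | rfl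
            · exact ha
            · exact hb
    have h2 := (Set.ncard_le_ncard hsub (Set.toFinite _)).trans (Set.ncard_union_le _ _)
    have h3 : (Sym2.map some '' E').ncard ≤ E'.ncard := Set.ncard_image_le (Set.toFinite _)
    have hinj : A'.map Function.Embedding.some = A.erase none := by
      rw [hA']; exact Finset.map_some_eraseNone A
    have h4 : A'.card = (A.erase none).card := by rw [← hinj, Finset.card_map]
    by_cases hn : none ∈ A
    · rw [if_pos hn, Set.ncard_singleton] at h2
      have := Finset.card_erase_add_one hn
      omega
    · rw [if_neg hn, Set.ncard_empty] at h2
      rw [Finset.erase_eq_of_notMem hn] at h4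
      omega
  · refine SimpleGraph.maxDegree_le_of_forall_degree_le _ _ (fun x => ?_)
    cases x with
    | none => rw [addLeaf_degree_none]; omega
    | some x =>
      rw [addLeaf_degree_some]
      have := hH.degree_le x
      split_ifs with h
      · subst h; omega
      · omega
  · rintro ⟨K, hK, hne, hreg⟩
    have hnone : none ∉ K.support := by
      intro hn
      have h3 := hreg none hn
      have hsub : K.neighborSet none ⊆ {some v} := by
        intro a ha
        have h := hK ha
        cases a with
        | none => exact absurd h (by simp)
        | some y =>
          have : y = v := h
          rw [this]; rfl
      have := Set.ncard_le_ncard hsub (Set.toFinite _)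
      rw [Set.ncard_singleton] at this
      omega
    have hnadj : ∀ a, ¬ K.Adj a none := fun a ha => hnone ⟨a, ha.symm⟩
    refine hH.2.2 ⟨K.comap some, ?_, ?_, ?_⟩
    · intro x y hxy
      exact hK hxy
    · obtain ⟨a, b, hab⟩ := hne
      cases a with
      | none => exact absurd hab.symm (hnadj b)
      | some x =>
        cases b with
        | none => exact absurd hab (hnadj _)
        | some y => exact ⟨x, y, hab⟩
    · rintro x ⟨y, hxy⟩
      have h3 := hreg (some x) ⟨some y, hxy⟩
      have : K.neighborSet (some x) = some '' ((K.comap some).neighborSet x) := by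
        ext a
        cases a with
        | none => simpa using hnadj (some x)
        | some y => simp
      rw [this, Set.ncard_image_of_injective _ (Option.some_injective _)] at h3
      exact h3

lemma conflict_some {V : Type} {H : SimpleGraph V} {v : V} {e e' : Sym2 V}
    (hc : Conflict H e e') : Conflict (addLeaf H v) (e.map some) (e'.map some) := by
  obtain ⟨h1, h2⟩ := hc
  refine ⟨fun h => h1 (Sym2.map.injective (Option.some_injective _) h), ?_⟩
  rcases h2 with ⟨p, hp, hp'⟩ | ⟨f, hf, ⟨p, hp, hpf⟩, ⟨q, hq, hqf⟩⟩
  · exact Or.inl ⟨some p, Sym2.mem_map.2 ⟨p, hp, rfl⟩, Sym2.mem_map.2 ⟨p, hp', rfl⟩⟩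
  · refine Or.inr ⟨f.map some, ?_,
      ⟨some p, Sym2.mem_map.2 ⟨p, hp, rfl⟩, Sym2.mem_map.2 ⟨p, hpf, rfl⟩⟩,
      ⟨some q, Sym2.mem_map.2 ⟨q, hq, rfl⟩, Sym2.mem_map.2 ⟨q, hqf, rfl⟩⟩⟩
    induction f with
    | _ x y => exact hf

/-- The first step of the reduction: a coloring of `G - uw` in which `uv` and `wz` get different
colors. -/
lemma first_coloring {V : Type} [Fintype V] {G : SimpleGraph V} {Δ : ℕ} (hG : MinCexB Δ G)
    {u v w z : V} (hN : G.neighborFinset u = {v, w}) (hvw : v ≠ w) (hwz : G.Adj w z)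
    (hzu : z ≠ u) (hv1 : G.degree v ≠ 1) (hw1 : G.degree w ≠ 1) (hv : (core G).degree v ≠ Δ) :
    ∃ C : Sym2 V → Fin (3 * Δ),
      IsStrongColoring (G.deleteEdges {s(u, w)}) C ∧ C s(u, v) ≠ C s(w, z) := by
  obtain ⟨hgood, hno, hmin⟩ := hG
  have hadj : ∀ y, G.Adj u y ↔ y = v ∨ y = w := by
    intro y
    rw [← SimpleGraph.mem_neighborFinset, hN]; simp
  have huv : G.Adj u v := (hadj v).2 (Or.inl rfl)
  have huw : G.Adj u w := (hadj w).2 (Or.inr rfl)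
  have hdu : G.degree u = 2 := by
    unfold SimpleGraph.degree
    rw [hN, Finset.card_pair hvw]
  obtain ⟨H, hH⟩ : ∃ H, H = G.deleteEdges {s(u, w)} := ⟨_, rfl⟩
  rw [← hH]
  have hle : H ≤ G := hH ▸ G.deleteEdges_le _
  have hHu : ∀ y, H.Adj u y ↔ y = v := by
    intro y
    rw [hH, SimpleGraph.deleteEdges_adj, hadj]
    constructor
    · rintro ⟨h | rfl, h2⟩
      · exact h
      · exact absurd rfl h2
    · rintro rfl
      refine ⟨Or.inl rfl, ?_⟩
      intro h
      rw [Set.mem_singleton_iff, Sym2.eq_iff] at h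
      rcases h with h | h
      · exact hvw h.2
      · exact huw.ne h.1
  have hHdu : H.degree u = 1 := by
    unfold SimpleGraph.degree
    have : H.neighborFinset u = {v} := by
      ext y; rw [SimpleGraph.mem_neighborFinset, hHu]; simp
    rw [this, Finset.card_singleton]
  by_cases hleaf : ∃ l, G.Adj v l ∧ G.degree l = 1
  · obtain ⟨l, hvl, hl1⟩ := hleaf
    have hul : u ≠ l := by rintro rfl; omega
    have hwl : w ≠ l := by rintro rfl; exact hw1 hl1
    have hzl : z ≠ l := by
      rintro rfl
      exact hvw (leaf_unique hl1 hvl.symm hwz.symm)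
    refine swap_coloring H (hmin V H (hgood.mono hle) (Or.inl ?_)) hul hHu ?_ huw.ne' hwl hzu hzl
    · unfold twoPlusCount
      refine Finset.card_lt_card ⟨fun x hx => ?_, fun hcon => ?_⟩
      · simp only [Finset.mem_filter, Finset.mem_univ, true_and] at *
        exact hx.trans (degree_mono hle x)
      · have : u ∈ Finset.univ.filter (fun x : V => 2 ≤ G.degree x) := by simp [hdu]
        have := hcon this
        simp only [Finset.mem_filter, Finset.mem_univ, true_and] at this
        omega
    · intro y
      constructor
      · intro h
        exact leaf_unique hl1 (hle h) hvl.symm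
      · rintro rfl
        rw [hH, SimpleGraph.deleteEdges_adj]
        refine ⟨hvl.symm, ?_⟩
        intro h
        rw [Set.mem_singleton_iff, Sym2.eq_iff] at h
        rcases h with h | h
        · exact hul h.1.symm
        · exact hwl h.1.symm
  · have hcore : (core G).neighborFinset v = G.neighborFinset v := by
      ext y
      rw [SimpleGraph.mem_neighborFinset, SimpleGraph.mem_neighborFinset, core_adj]
      constructor
      · exact fun h => h.1
      · exact fun h => ⟨h, hv1, fun h1 => hleaf ⟨y, h, h1⟩⟩
    have hdv : (core G).degree v = G.degree v := by
      unfold SimpleGraph.degree; rw [hcore]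
    have hdv' : G.degree v < Δ := lt_of_le_of_ne (hgood.degree_le v) (hdv ▸ hv)
    have hHv : H.degree v < Δ := (degree_mono hle v).trans_lt hdv'
    have hv2 : 2 ≤ G.degree v := by
      have : 0 < G.degree v := (G.degree_pos_iff_exists_adj v).2 ⟨u, huv.symm⟩
      omega
    obtain ⟨C, hC, hne⟩ := swap_coloring (addLeaf H v) (u := some u) (l := none) (v := some v)
      (w := some w) (z := some z)
      (hmin (Option V) (addLeaf H v) (addLeaf_good (hgood.mono hle) hHv) (Or.inl (by
        unfold twoPlusCount
        have hsub : (Finset.univ.filter (fun a : Option V => 2 ≤ (addLeaf H v).degree a)) ⊆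
            (((Finset.univ.filter (fun x : V => 2 ≤ G.degree x)).erase u).map
              Function.Embedding.some) := by
          intro a ha
          simp only [Finset.mem_filter, Finset.mem_univ, true_and] at ha
          cases a with
          | none => rw [addLeaf_degree_none] at ha; omega
          | some x =>
            rw [addLeaf_degree_some] at ha
            rw [Finset.mem_map]
            refine ⟨x, ?_, rfl⟩
            rw [Finset.mem_erase, Finset.mem_filter]
            by_cases hx : x = v
            · subst hx
              exact ⟨huv.ne', Finset.mem_univ _, hv2⟩
            · rw [if_neg hx] at ha
              refine ⟨?_, Finset.mem_univ _, ?_⟩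
              · rintro rfl; omega
              · have := degree_mono hle x; omega
        have h1 := Finset.card_le_card hsub
        rw [Finset.card_map] at h1
        refine h1.trans_lt (Finset.card_erase_lt_of_mem ?_)
        simp [hdu])))
      (by simp) (by
        intro y
        cases y with
        | none => simpa [addLeaf] using huv.ne
        | some y => simpa [addLeaf] using hHu y)
      (by
        intro y
        cases y <;> simp [addLeaf])
      (by simpa using huw.ne') (by simp) (by simpa using hzu) (by simp)
    refine ⟨fun e => C (e.map some), ?_, ?_⟩
    · intro e he e' he' hcf
      have hh : ∀ e ∈ H.edgeSet, e.map some ∈ (addLeaf H v).edgeSet := by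
        intro e he
        induction e with
        | _ x y => exact he
      exact hC _ (hh e he) _ (hh e' he') (conflict_some hcf)
    · simpa using hne

/-- The second step of the reduction: recoloring the edges at `w`. -/
lemma reduction {V : Type} [Fintype V] {G : SimpleGraph V} {Δ : ℕ} (hΔ : 7 ≤ Δ)
    (hG : MinCexB Δ G)
    {u v w z : V} (hN : G.neighborFinset u = {v, w}) (hvw : v ≠ w) (hwz : G.Adj w z)
    (hzu : z ≠ u) (hv1 : G.degree v ≠ 1) (hw1 : G.degree w ≠ 1) (hv : (core G).degree v ≠ Δ)
    (hw4 : G.degree w ≤ 4) (h3 : ∀ x, G.Adj w x → x ≠ z → G.degree x ≤ 3)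
    (hlow : ∀ x, G.Adj w x → x ≠ z → x ≠ u → nb G x w ≤ Δ + 2) : False := by
  obtain ⟨C, hC, hne⟩ := first_coloring hG hN hvw hwz hzu hv1 hw1 hv
  have hgood := hG.1
  have hadj : ∀ y, G.Adj u y ↔ y = v ∨ y = w := by
    intro y
    rw [← SimpleGraph.mem_neighborFinset, hN]; simp
  have huw : G.Adj u w := (hadj w).2 (Or.inr rfl)
  have hdu : G.degree u = 2 := by
    unfold SimpleGraph.degree
    rw [hN, Finset.card_pair hvw]
  have hE : ∀ e, e ∈ (G.deleteEdges {s(u, w)}).edgeSet ↔ e ∈ G.edgeSet ∧ e ≠ s(u, w) := by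
    intro e
    rw [SimpleGraph.edgeSet_deleteEdges]
    simp
  have hwzne : s(w, z) ≠ s(u, w) := by
    intro h
    rw [Sym2.eq_iff] at h
    rcases h with h | h
    · exact huw.ne h.1.symm
    · exact hzu h.2
  -- the colored edges
  let S : Finset V → Set (Sym2 V) := fun X =>
    {e | e ∈ G.edgeSet ∧ (w ∉ e ∨ e = s(w, z) ∨ ∃ x ∈ X, e = s(w, x))}
  have hS0 : PartialOK G (S ∅) C := by
    have hcl : ∀ e ∈ S ∅, e ∈ G.edgeSet ∧ (w ∉ e ∨ e = s(w, z)) := by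
      rintro e ⟨h1, h2 | h2 | ⟨x, hx, _⟩⟩
      · exact ⟨h1, Or.inl h2⟩
      · exact ⟨h1, Or.inr h2⟩
      · simp at hx
    have hin : ∀ e ∈ S ∅, e ∈ (G.deleteEdges {s(u, w)}).edgeSet := by
      intro e he
      rw [hE]
      refine ⟨(hcl e he).1, ?_⟩
      rintro rfl
      rcases (hcl _ he).2 with h | h
      · exact h (by simp)
      · exact hwzne h.symm
    have hcase : ∀ e ∈ S ∅, ∀ p, p ∈ e → p ∈ s(u, w) → e = s(u, v) ∨ e = s(w, z) := by
      intro e he p hp hpf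
      rcases (hcl e he).2 with hwe | h
      · rcases Sym2.mem_iff.1 hpf with rfl | rfl
        · obtain ⟨q, rfl⟩ := Sym2.mem_iff_exists.1 hp
          rcases (hadj q).1 (hcl _ he).1 with rfl | rfl
          · exact Or.inl rfl
          · exact absurd (by simp) hwe
        · exact absurd hp hwe
      · exact Or.inr h
    intro e he e' he' hcf
    by_cases hcc : Conflict (G.deleteEdges {s(u, w)}) e e'
    · exact hC e (hin e he) e' (hin e' he') hcc
    · rcases hcf.2 with h | ⟨f, hf, ⟨p, hp, hpf⟩, ⟨q, hq, hqf⟩⟩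
      · exact absurd ⟨hcf.1, Or.inl h⟩ hcc
      · by_cases hfe : f = s(u, w)
        · subst hfe
          rcases hcase e he p hp hpf with rfl | rfl
          · rcases hcase e' he' q hq hqf with rfl | rfl
            · exact absurd rfl hcf.1
            · exact hne
          · rcases hcase e' he' q hq hqf with rfl | rfl
            · exact hne.symm
            · exact absurd rfl hcf.1
        · exact absurd ⟨hcf.1, Or.inr ⟨f, (hE f).2 ⟨hf, hfe⟩, ⟨p, hp, hpf⟩, ⟨q, hq, hqf⟩⟩⟩ hcc
  have huN : u ∈ G.neighborFinset w := by simpa using huw.symm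
  have hzN : z ∈ G.neighborFinset w := by simpa using hwz
  have hcardw : (G.neighborFinset w).card ≤ 4 := hw4
  have hdz := hgood.degree_le z
  -- extension along the low neighbors of `w`
  have hstep : ∀ X : Finset V, (∀ x ∈ X, G.Adj w x ∧ x ≠ z ∧ x ≠ u) →
      ∃ C' : Sym2 V → Fin (3 * Δ), PartialOK G (S X) C' := by
    intro X
    induction X using Finset.induction_on with
    | empty => exact fun _ => ⟨C, hS0⟩
    | insert x X hxX ih =>
      intro hX
      obtain ⟨C1, hC1⟩ := ih (fun y hy => hX y (Finset.mem_insert_of_mem hy))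
      obtain ⟨hwx, hxz, hxu⟩ := hX x (Finset.mem_insert_self _ _)
      have hnotin : s(u, w) ∉ S X := by
        rintro ⟨-, h | h | ⟨y, hy, h⟩⟩
        · exact h (by simp)
        · exact hwzne h.symm
        · rw [Sym2.eq_iff] at h
          rcases h with h | h
          · exact huw.ne h.1
          · exact (hX y (Finset.mem_insert_of_mem hy)).2.2 h.1.symm
      obtain ⟨C2, hC2⟩ := extend_coloring G (S X) C1 hC1 s(w, x)
        ((nbE G w x ∪ nbE G x w).erase s(u, w))
        (by
          intro e' he' hcf
          rw [Finset.mem_erase]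
          refine ⟨?_, conflict_mem G w x e' he'.1 hcf⟩
          rintro rfl
          exact hnotin he')
        (by
          have hmem : s(u, w) ∈ nbE G w x ∪ nbE G x w := by
            rw [Finset.mem_union]
            left
            rw [mem_nbE]
            exact ⟨u, hxu.symm, huw.symm, huw, by simp⟩
          have h1 := Finset.card_erase_add_one hmem
          have h2 := Finset.card_union_le (nbE G w x) (nbE G x w)
          have h4 := card_nbE G w x
          have h5 := card_nbE G x w
          have h6 := hlow x hwx hxz hxu
          have h7 : nb G w x ≤ Δ + 5 := by
            unfold nb
            have hxN : x ∈ G.neighborFinset w := by simpa using hwx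
            have hz' : z ∈ (G.neighborFinset w).erase x := Finset.mem_erase.2 ⟨hxz.symm, hzN⟩
            have hu' : u ∈ ((G.neighborFinset w).erase x).erase z :=
              Finset.mem_erase.2 ⟨hzu.symm, Finset.mem_erase.2 ⟨hxu.symm, huN⟩⟩
            rw [← Finset.sum_erase_add _ _ hz', ← Finset.sum_erase_add _ _ hu']
            have hb := Finset.sum_le_card_nsmul
              ((((G.neighborFinset w).erase x).erase z).erase u) (fun p => G.degree p) 3 (by
                intro p hp
                simp only [Finset.mem_erase, SimpleGraph.mem_neighborFinset] at hp
                exact h3 p hp.2.2.2 hp.2.1)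
            have c1 := Finset.card_erase_add_one hu'
            have c2 := Finset.card_erase_add_one hz'
            have c3 := Finset.card_erase_add_one hxN
            rw [smul_eq_mul] at hb
            omega
          omega)
      refine ⟨C2, fun e he e' he' hcf => hC2 e ?_ e' ?_ hcf⟩
      · rcases he with ⟨h1, h | h | ⟨y, hy, h⟩⟩
        · exact Or.inr ⟨h1, Or.inl h⟩
        · exact Or.inr ⟨h1, Or.inr (Or.inl h)⟩
        · rcases Finset.mem_insert.1 hy with rfl | hy
          · exact Or.inl h
          · exact Or.inr ⟨h1, Or.inr (Or.inr ⟨y, hy, h⟩)⟩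
      · rcases he' with ⟨h1, h | h | ⟨y, hy, h⟩⟩
        · exact Or.inr ⟨h1, Or.inl h⟩
        · exact Or.inr ⟨h1, Or.inr (Or.inl h)⟩
        · rcases Finset.mem_insert.1 hy with rfl | hy
          · exact Or.inl h
          · exact Or.inr ⟨h1, Or.inr (Or.inr ⟨y, hy, h⟩)⟩
  obtain ⟨C1, hC1⟩ := hstep (((G.neighborFinset w).erase z).erase u) (by
    intro x hx
    simp only [Finset.mem_erase, SimpleGraph.mem_neighborFinset] at hx
    exact ⟨hx.2.2, hx.2.1, hx.1⟩)
  obtain ⟨C2, hC2⟩ := extend_coloring G _ C1 hC1 s(u, w) (nbE G u w ∪ nbE G w u)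
    (fun e' he' hcf => conflict_mem G u w e' he'.1 hcf)
    (by
      have h2 := Finset.card_union_le (nbE G u w) (nbE G w u)
      have h4 := card_nbE G u w
      have h5 := card_nbE G w u
      have h6 : nb G u w ≤ Δ := by
        unfold nb
        have : (G.neighborFinset u).erase w = {v} := by
          rw [hN]; ext y
          simp only [Finset.mem_erase, Finset.mem_insert, Finset.mem_singleton]
          constructor
          · rintro ⟨h, h' | h'⟩
            · exact h'
            · exact absurd h' h
          · rintro rfl
            exact ⟨hvw, Or.inl rfl⟩
        rw [this, Finset.sum_singleton]
        exact hgood.degree_le v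
      have h7 : nb G w u ≤ Δ + 6 := by
        unfold nb
        have hz' : z ∈ (G.neighborFinset w).erase u := Finset.mem_erase.2 ⟨hzu, hzN⟩
        rw [← Finset.sum_erase_add _ _ hz']
        have hb := Finset.sum_le_card_nsmul
          (((G.neighborFinset w).erase u).erase z) (fun p => G.degree p) 3 (by
            intro p hp
            simp only [Finset.mem_erase, SimpleGraph.mem_neighborFinset] at hp
            exact h3 p hp.2.2 hp.1)
        have c2 := Finset.card_erase_add_one hz'
        have c3 := Finset.card_erase_add_one huN
        rw [smul_eq_mul] at hb
        omega
      omega)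
  have hall : ∀ e ∈ G.edgeSet,
      e ∈ insert s(u, w) (S (((G.neighborFinset w).erase z).erase u)) := by
    intro e he
    by_cases hwe : w ∈ e
    · obtain ⟨q, rfl⟩ := Sym2.mem_iff_exists.1 hwe
      by_cases hqu : q = u
      · subst hqu
        exact Or.inl Sym2.eq_swap
      · right
        refine ⟨he, Or.inr ?_⟩
        by_cases hqz : q = z
        · subst hqz; exact Or.inl rfl
        · right
          refine ⟨q, ?_, rfl⟩
          simp only [Finset.mem_erase, SimpleGraph.mem_neighborFinset]
          exact ⟨hqu, hqz, he⟩
    · exact Or.inr ⟨he, Or.inl hwe⟩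
  exact hG.2.1 ⟨C2, fun e he e' he' hcf => hC2 e (hall e he) e' (hall e' he') hcf⟩

/-- A vertex of degree 2 in the core has no pendant neighbor. -/
lemma two_leafless {V : Type} [Fintype V] {G : SimpleGraph V} {Δ : ℕ}
    (hG : MinCexB Δ G) {x : V} (hx : (core G).degree x = 2) :
    (core G).neighborFinset x = G.neighborFinset x := by
  have hx1 : G.degree x ≠ 1 := by
    have := degree_mono (core_le G) x
    omega
  refine leafless hG hx1 ?_
  have hb := Finset.sum_le_card_nsmul ((core G).neighborFinset x) (fun p => G.degree p) Δ
    (fun p _ => hG.1.degree_le p)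
  rw [SimpleGraph.card_neighborFinset_eq_degree, hx, smul_eq_mul] at hb
  omega

lemma degree_eq_of_nbr {V : Type} [Fintype V] {G H : SimpleGraph V} {x : V}
    (h : H.neighborFinset x = G.neighborFinset x) : G.degree x = H.degree x := by
  unfold SimpleGraph.degree
  rw [h]

lemma poor_facts {V : Type} [Fintype V] {G : SimpleGraph V} {Δ : ℕ}
    (hG : MinCexB Δ G) {x : V} (hx : Poor3 G x) :
    G.degree x = 3 ∧ ∃ y, (core G).degree y = 2 ∧ G.degree y = 2 ∧ G.Adj x y := by
  obtain ⟨h3, h1⟩ := hx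
  obtain ⟨y, hy⟩ := Finset.card_eq_one.1 h1
  have hy' : y ∈ ((core G).neighborFinset x).filter (fun u => (core G).degree u = 2) := by
    rw [hy]; simp
  rw [Finset.mem_filter] at hy'
  obtain ⟨hyN, hy2⟩ := hy'
  have hdy : G.degree y = 2 := by rw [degree_eq_of_nbr (two_leafless hG hy2), hy2]
  have hx1 : G.degree x ≠ 1 := by
    have := degree_mono (core_le G) x
    omega
  have hnb := leafless hG hx1 (by
    have hb := Finset.sum_le_card_nsmul (((core G).neighborFinset x).erase y)
      (fun p => G.degree p) Δ (fun p _ => hG.1.degree_le p)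
    have c := Finset.card_erase_add_one hyN
    rw [SimpleGraph.card_neighborFinset_eq_degree, h3] at c
    have c' : (((core G).neighborFinset x).erase y).card = 2 := by omega
    rw [c', smul_eq_mul] at hb
    rw [← Finset.sum_erase_add _ _ hyN]
    omega)
  refine ⟨by rw [degree_eq_of_nbr hnb, h3], y, hy2, hdy, ?_⟩
  exact core_le G (by simpa using hyN)


/-- In a minimal counterexample `G` to `χ'_s ≤ 3Δ` (`Mad ≤ 3`, maximum degree at most
`Δ ≥ 7`, no 3-regular subgraph), every sponsor of a very poor vertex has degree exactly
`Δ` in `G*`. -/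
theorem minCexB_sponsor_degree (Δ : ℕ) (hΔ : 7 ≤ Δ) {V : Type} [Fintype V]
    (G : SimpleGraph V) (hG : MinCexB Δ G) (u v w : V)
    (hvp : VeryPoorWith G u v w) :
    (core G).degree v = Δ := by
  by_contra hv
  obtain ⟨hu2, huv, huw, hvw, hT⟩ := hvp
  have hgood := hG.1
  have huv' := core_adj.1 huv
  have huw' := core_adj.1 huw
  have hNu := two_leafless hG hu2
  have hN : G.neighborFinset u = {v, w} := by
    rw [← hNu]
    symm
    refine Finset.eq_of_subset_of_card_le ?_ ?_
    · intro y hy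
      rw [SimpleGraph.mem_neighborFinset]
      rcases Finset.mem_insert.1 hy with rfl | hy
      · exact huv
      · rw [Finset.mem_singleton.1 hy]; exact huw
    · rw [SimpleGraph.card_neighborFinset_eq_degree, hu2, Finset.card_pair hvw]
  set low : V → Prop := fun x => (core G).degree x = 2 ∨ Poor3 G x with hlowdef
  have huN : u ∈ (core G).neighborFinset w := by
    rw [SimpleGraph.mem_neighborFinset]; exact huw.symm
  have hulow : low u := Or.inl hu2
  have hsplit : (((core G).neighborFinset w).filter (fun x => low x)).card +
      (((core G).neighborFinset w).filter (fun x => ¬ low x)).card = (core G).degree w :=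
    Finset.card_filter_add_card_filter_not _
  -- the uniform description of the three cases
  have hk : 2 ≤ (core G).degree w ∧ (core G).degree w ≤ 4 ∧
      (((core G).neighborFinset w).filter (fun x => ¬ low x)).card ≤ 1 := by
    rcases hT with h | ⟨h, h'⟩ | ⟨h, h'⟩
    · refine ⟨h.ge, by omega, ?_⟩
      have : 1 ≤ (((core G).neighborFinset w).filter (fun x => low x)).card :=
        Finset.card_pos.2 ⟨u, Finset.mem_filter.2 ⟨huN, hulow⟩⟩
      omega
    · refine ⟨by omega, by omega, ?_⟩
      have : (((core G).neighborFinset w).filter (fun x => (core G).degree x = 2)).card ≤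
          (((core G).neighborFinset w).filter (fun x => low x)).card := by
        refine Finset.card_le_card (fun x hx => ?_)
        rw [Finset.mem_filter] at *
        exact ⟨hx.1, Or.inl hx.2⟩
      omega
    · exact ⟨by omega, by omega, h'⟩
  obtain ⟨hk2, hk4, hkn⟩ := hk
  have hlow3 : ∀ x, low x → G.degree x ≤ 3 := by
    rintro x (hx | hx)
    · rw [degree_eq_of_nbr (two_leafless hG hx), hx]; omega
    · exact (poor_facts hG hx).1.le
  obtain ⟨z, hzN, hzu, hzlow⟩ : ∃ z ∈ (core G).neighborFinset w, z ≠ u ∧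
      ∀ x ∈ (core G).neighborFinset w, x ≠ z → low x := by
    by_cases hex : ∃ z ∈ (core G).neighborFinset w, ¬ low z
    · obtain ⟨z, hz, hzl⟩ := hex
      refine ⟨z, hz, ?_, ?_⟩
      · rintro rfl; exact hzl hulow
      · intro x hx hxz
        by_contra hxl
        exact hxz (Finset.card_le_one.1 hkn x (Finset.mem_filter.2 ⟨hx, hxl⟩) z
          (Finset.mem_filter.2 ⟨hz, hzl⟩))
    · push Not at hex
      have c := Finset.card_erase_add_one huN
      rw [SimpleGraph.card_neighborFinset_eq_degree] at c
      obtain ⟨z, hz⟩ := Finset.card_pos.1 (show 0 < (((core G).neighborFinset w).erase u).card by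
        omega)
      rw [Finset.mem_erase] at hz
      exact ⟨z, hz.2, hz.1, fun x hx _ => hex x hx⟩
  have hNw := leafless hG huw'.2.2 (by
    have hb := Finset.sum_le_card_nsmul (((core G).neighborFinset w).erase z)
      (fun p => G.degree p) 3 (by
        intro p hp
        rw [Finset.mem_erase] at hp
        exact hlow3 p (hzlow p hp.2 hp.1))
    have c := Finset.card_erase_add_one hzN
    rw [SimpleGraph.card_neighborFinset_eq_degree] at c
    rw [smul_eq_mul] at hb
    have := hgood.degree_le z
    rw [← Finset.sum_erase_add _ _ hzN]
    omega)
  have hdw : G.degree w = (core G).degree w := degree_eq_of_nbr hNw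
  have hadjw : ∀ x, G.Adj w x → x ∈ (core G).neighborFinset w := by
    intro x hx
    rw [hNw, SimpleGraph.mem_neighborFinset]; exact hx
  have hwz : G.Adj w z := by
    rw [hNw, SimpleGraph.mem_neighborFinset] at hzN; exact hzN
  refine reduction hΔ hG hN hvw hwz hzu huv'.2.2 huw'.2.2 hv (by omega)
    (fun x hx hxz => hlow3 x (hzlow x (hadjw x hx) hxz)) ?_
  intro x hwx hxz hxu
  have hwN : w ∈ G.neighborFinset x := by
    rw [SimpleGraph.mem_neighborFinset]; exact hwx.symm
  have cw := Finset.card_erase_add_one hwN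
  rw [SimpleGraph.card_neighborFinset_eq_degree] at cw
  -- `w` has at least three neighbors
  have hw3 : (core G).degree w ≠ 2 := by
    intro h2
    have hc : ({u, z, x} : Finset V).card ≤ (core G).degree w := by
      rw [← SimpleGraph.card_neighborFinset_eq_degree]
      refine Finset.card_le_card (fun y hy => ?_)
      simp only [Finset.mem_insert, Finset.mem_singleton] at hy
      rcases hy with rfl | rfl | rfl
      · exact huN
      · exact hzN
      · exact hadjw _ hwx
    rw [Finset.card_eq_three.2 ⟨u, z, x, hzu.symm, hxu.symm, hxz.symm, rfl⟩] at hc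
    omega
  unfold nb
  rcases hzlow x (hadjw x hwx) hxz with hx | hx
  · have hdx : G.degree x = 2 := by rw [degree_eq_of_nbr (two_leafless hG hx), hx]
    have hb := Finset.sum_le_card_nsmul ((G.neighborFinset x).erase w)
      (fun p => G.degree p) Δ (fun p _ => hgood.degree_le p)
    have c' : ((G.neighborFinset x).erase w).card = 1 := by omega
    rw [c', smul_eq_mul] at hb
    omega
  · obtain ⟨hdx, y, hy2, hdy, hxy⟩ := poor_facts hG hx
    have hyw : y ≠ w := by rintro rfl; exact hw3 hy2
    have hyN : y ∈ (G.neighborFinset x).erase w := by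
      rw [Finset.mem_erase, SimpleGraph.mem_neighborFinset]; exact ⟨hyw, hxy⟩
    have hb := Finset.sum_le_card_nsmul (((G.neighborFinset x).erase w).erase y)
      (fun p => G.degree p) Δ (fun p _ => hgood.degree_le p)
    have c := Finset.card_erase_add_one hyN
    have c' : (((G.neighborFinset x).erase w).erase y).card = 1 := by omega
    rw [c', smul_eq_mul] at hb
    rw [← Finset.sum_erase_add _ _ hyN]
    omega

end StrongEC
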